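/- (Strong form of the Nullstellensatz.) (a) I(Z(J_0)) = J_0 for every J_0 ∈ Spec_n(G_{m,n}). (b) I_T(Z(J)) = J for every J ∈ Spec_n(T_{m,n}). -/

import Mathlib

set_option linter.unusedSectionVars false

noncomputable section

universe u

-- Throughout, `k` is an algebraically closed base field of characteristic zero.
variable (k : Type) [Field k] [IsAlgClosed k] [CharZero k]

/-- Index type for the `m·n²` commuting variables `x_{ij}^{(h)}`. -/
abbrev MIdx (n m : ℕ) := Fin m × Fin n × Fin n

/-- The commutative polynomial ring `k[x_{ij}^{(h)}]`. -/
abbrev PolyRing (n m : ℕ) := MvPolynomial (MIdx n m) k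

/-- Matrices over the polynomial ring `k[x_{ij}^{(h)}]`. -/
abbrev MatPoly (n m : ℕ) := Matrix (Fin n) (Fin n) (PolyRing k n m)

/-- The space `(M_n)^m` of `m`-tuples of `n×n` matrices over `k`. -/
abbrev MTuple (n m : ℕ) := Fin m → Matrix (Fin n) (Fin n) k

/-- The `h`-th generic `n×n` matrix `X_h = (x_{ij}^{(h)})`. -/
def genericMatrix (n m : ℕ) (h : Fin m) : MatPoly k n m :=
  Matrix.of fun i j => MvPolynomial.X (h, i, j)

/-- `G_{m,n}`, the algebra of `m` generic `n×n` matrices: the `k`-subalgebra of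
`M_n(k[x_{ij}^{(h)}])` generated by the generic matrices. -/
def GMN (n m : ℕ) : Subalgebra k (MatPoly k n m) :=
  Algebra.adjoin k (Set.range (genericMatrix k n m))

/-- Evaluation of the commuting variables at a point `a ∈ (M_n)^m`. -/
def polyEval {n m : ℕ} (a : MTuple k n m) : PolyRing k n m →ₐ[k] k :=
  MvPolynomial.aeval fun x : MIdx n m => a x.1 x.2.1 x.2.2

/-- Evaluation of matrix-valued polynomials at a point `a ∈ (M_n)^m`; under this
map an element of `G_{m,n}` (or `T_{m,n}`) becomes a `PGL_n`-equivariant polynomial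
map `(M_n)^m → M_n`. -/
def evalMat {n m : ℕ} (a : MTuple k n m) :
    MatPoly k n m →ₐ[k] Matrix (Fin n) (Fin n) k :=
  (polyEval k a).mapMatrix

/-- The scalar matrix `tr(p)·1 ∈ M_n(k[x_{ij}^{(h)}])`. -/
def traceScalar {n m : ℕ} (p : MatPoly k n m) : MatPoly k n m :=
  algebraMap (PolyRing k n m) (MatPoly k n m) (Matrix.trace p)

/-- `T_{m,n}`, the trace ring of `G_{m,n}`: the `k`-algebra generated inside
`M_n(k[x_{ij}^{(h)}])` by `G_{m,n}` together with the traces of its elements. -/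
def TMN (n m : ℕ) : Subalgebra k (MatPoly k n m) :=
  Algebra.adjoin k ((GMN k n m : Set (MatPoly k n m)) ∪
    (traceScalar k '' (GMN k n m : Set (MatPoly k n m))))

lemma GMN_le_TMN (n m : ℕ) : GMN k n m ≤ TMN k n m :=
  fun _ hx => Algebra.subset_adjoin (Or.inl hx)

/-- The inclusion `G_{m,n} → T_{m,n}`. -/
def inclGT (n m : ℕ) : ↥(GMN k n m) →+* ↥(TMN k n m) :=
  (Subalgebra.inclusion (GMN_le_TMN k n m) : ↥(GMN k n m) →ₐ[k] ↥(TMN k n m)).toRingHom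

/-- `U_{m,n}`: the set of `m`-tuples of `n×n` matrices generating `M_n` as a
`k`-algebra. -/
def genTuples (n m : ℕ) : Set (MTuple k n m) :=
  {a | Algebra.adjoin k (Set.range a) = ⊤}

/-- Simultaneous conjugation of an `m`-tuple by `g ∈ GL_n(k)`; since scalar
matrices act trivially, this is the `PGL_n`-action on `(M_n)^m`. -/
def conjAct {n m : ℕ} (g : GL (Fin n) k) (a : MTuple k n m) : MTuple k n m :=
  fun i =>
    (g : Matrix (Fin n) (Fin n) k) * a i * ((g⁻¹ : GL (Fin n) k) : Matrix (Fin n) (Fin n) k)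

/-- Zariski closed subsets of `(M_n)^m`. -/
def IsZClosed {n m : ℕ} (C : Set (MTuple k n m)) : Prop :=
  ∃ S : Set (PolyRing k n m), C = {a | ∀ p ∈ S, polyEval k a p = 0}

/-- `X` is an `n`-variety: a closed `PGL_n`-invariant subvariety of `U_{m,n}`,
i.e. `X = X̄ ∩ U_{m,n}` where `X̄` is the Zariski closure of `X` in `(M_n)^m`. -/
def IsNVariety {n m : ℕ} (X : Set (MTuple k n m)) : Prop :=
  X ⊆ genTuples k n m ∧
  (∀ g : GL (Fin n) k, ∀ a ∈ X, conjAct k g a ∈ X) ∧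
  ∃ C, IsZClosed k C ∧ X = C ∩ genTuples k n m

/-- Irreducibility of a subset of `(M_n)^m` with respect to the Zariski topology. -/
def IsIrredSubset {n m : ℕ} (X : Set (MTuple k n m)) : Prop :=
  X.Nonempty ∧ ∀ C₁ C₂ : Set (MTuple k n m), IsZClosed k C₁ → IsZClosed k C₂ →
    X ⊆ C₁ ∪ C₂ → X ⊆ C₁ ∨ X ⊆ C₂

/-- The zero locus in `U_{m,n}` of a set of matrix-valued polynomials. -/
def zeroLocus {n m : ℕ} (S : Set (MatPoly k n m)) : Set (MTuple k n m) :=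
  {a | a ∈ genTuples k n m ∧ ∀ p ∈ S, evalMat k a p = 0}

/-- The zero locus in `U_{m,n}` of a two-sided ideal of a subalgebra `A` of
`M_n(k[x_{ij}^{(h)}])` (such as `G_{m,n}` or `T_{m,n}`). -/
def zeroLocusI {n m : ℕ} {A : Subalgebra k (MatPoly k n m)} (J : TwoSidedIdeal ↥A) :
    Set (MTuple k n m) :=
  {a | a ∈ genTuples k n m ∧ ∀ p : ↥A, p ∈ J → evalMat k a (p : MatPoly k n m) = 0}

/-- The vanishing (two-sided) ideal of a subset `X ⊆ (M_n)^m` in a subalgebra `A`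
of `M_n(k[x_{ij}^{(h)}])`; for `A = G_{m,n}` this is `I(X)`, for `A = T_{m,n}`
this is `I_T(X)`. -/
def vanishIdeal {n m : ℕ} (A : Subalgebra k (MatPoly k n m)) (X : Set (MTuple k n m)) :
    TwoSidedIdeal ↥A :=
  TwoSidedIdeal.mk' {p : ↥A | ∀ a ∈ X, evalMat k a (p : MatPoly k n m) = 0}
    (fun a _ => by simp)
    (fun {p q} hp hq a ha => by
      have : ((p + q : ↥A) : MatPoly k n m) = (p : MatPoly k n m) + q := rfl
      simp [this, map_add, hp a ha, hq a ha])
    (fun {p} hp a ha => by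
      have : ((-p : ↥A) : MatPoly k n m) = -(p : MatPoly k n m) := rfl
      simp [this, map_neg, hp a ha])
    (fun {p q} hq a ha => by
      have : ((p * q : ↥A) : MatPoly k n m) = (p : MatPoly k n m) * q := rfl
      simp [this, map_mul, hq a ha])
    (fun {p q} hp a ha => by
      have : ((p * q : ↥A) : MatPoly k n m) = (p : MatPoly k n m) * q := rfl
      simp [this, map_mul, hp a ha])

/-- Restriction: a matrix-valued polynomial gives an `M_n`-valued function on `X`. -/
def restrictTo {n m : ℕ} (X : Set (MTuple k n m)) :
    MatPoly k n m →ₐ[k] (X → Matrix (Fin n) (Fin n) k) :=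
  Pi.algHom k _ fun a => evalMat k a.val

/-- The PI-coordinate ring `k_n[X] = G_{m,n}/I(X)`, realized concretely as the
algebra of all restrictions to `X` of elements of `G_{m,n}` (i.e. of
`PGL_n`-equivariant morphisms `X → M_n` coming from `G_{m,n}`). -/
def coordRing {n m : ℕ} (X : Set (MTuple k n m)) :
    Subalgebra k (X → Matrix (Fin n) (Fin n) k) :=
  (GMN k n m).map (restrictTo k X)

/-- The ring `T_{m,n}/I_T(X)`, realized concretely as the algebra of all
restrictions to `X` of elements of `T_{m,n}`. -/
def coordTraceRing {n m : ℕ} (X : Set (MTuple k n m)) :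
    Subalgebra k (X → Matrix (Fin n) (Fin n) k) :=
  (TMN k n m).map (restrictTo k X)

/-- A ring is prime if it is nonzero and `a·R·b = 0` implies `a = 0` or `b = 0`. -/
def IsPrimeRing (R : Type u) [Ring R] : Prop :=
  Nontrivial R ∧ ∀ a b : R, (∀ x : R, a * x * b = 0) → a = 0 ∨ b = 0

/-- `Q` is a central simple algebra of degree `n`: a simple ring whose center is a
field, and which has dimension `n²` over its center. -/
def IsCSAOfDegree (n : ℕ) (Q : Type u) [Ring Q] : Prop :=
  IsSimpleRing Q ∧
  ∃ (K : Type u) (_ : Field K) (_ : Algebra K Q),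
    (algebraMap K Q).range = Subring.center Q ∧ Module.finrank K Q = n ^ 2

/-- A (prime PI-) ring `R` has PI-degree `n` if its total ring of fractions — the
central localization of `R` at its nonzero central elements — is a central simple
algebra of degree `n`. -/
def HasPIDegree (n : ℕ) (R : Type u) [Ring R] : Prop :=
  ∃ (Q : Type u) (_ : Ring Q) (f : R →+* Q),
    Function.Injective f ∧
    (∀ c ∈ Subring.center R, c ≠ 0 → IsUnit (f c)) ∧
    (∀ q : Q, ∃ r : R, ∃ c ∈ Subring.center R, c ≠ 0 ∧ q * f c = f r) ∧
    IsCSAOfDegree n Q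

/-- The quotient of a ring by a two-sided ideal. -/
abbrev idealQuot {R : Type u} [Ring R] (J : TwoSidedIdeal R) : Type u := J.ringCon.Quotient

/-- `Spec_n(R)`: the set of prime (two-sided) ideals `J` of `R` such that `R/J` is a
prime ring of PI-degree `n`. -/
def SpecN (n : ℕ) (R : Type u) [Ring R] : Set (TwoSidedIdeal R) :=
  {J | IsPrimeRing (idealQuot J) ∧ HasPIDegree n (idealQuot J)}

/-- A regular map of `n`-varieties `X → Y ⊆ U_{l,n}`: a map of the form
`a ↦ (f₁(a), …, f_l(a))` with each `f_i ∈ k_n[X]`, i.e. each component is the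
restriction to `X` of an element of `G_{m,n}`. -/
def IsRegMapOn {n m l : ℕ} (X : Set (MTuple k n m)) (Y : Set (MTuple k n l))
    (φ : MTuple k n m → MTuple k n l) : Prop :=
  (∀ a ∈ X, φ a ∈ Y) ∧
  ∃ F : Fin l → MatPoly k n m, (∀ i, F i ∈ GMN k n m) ∧
    ∀ a ∈ X, ∀ i, φ a i = evalMat k a (F i)

/-- `X` and `Y` are isomorphic `n`-varieties: there are mutually inverse regular
maps of `n`-varieties between them. -/
def NIsomorphic {n m l : ℕ} (X : Set (MTuple k n m)) (Y : Set (MTuple k n l)) : Prop :=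
  ∃ (φ : MTuple k n m → MTuple k n l) (ψ : MTuple k n l → MTuple k n m),
    IsRegMapOn k X Y φ ∧ IsRegMapOn k Y X ψ ∧
    (∀ a ∈ X, ψ (φ a) = a) ∧ (∀ b ∈ Y, φ (ψ b) = b)

section Helpers
open scoped TensorProduct
open Equiv

theorem tensor_simple (K Q L : Type*) [Field K] [Ring Q] [Algebra K Q] [IsSimpleRing Q]
    (hc : ∀ q : Q, (∀ r, r * q = q * r) → ∃ c : K, algebraMap K Q c = q)
    [Field L] [Algebra K L] : IsSimpleRing (Q ⊗[K] L) := by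
  classical
  let b := Module.Basis.ofVectorSpace K L
  let B := Algebra.TensorProduct.basis Q b
  have hB : ∀ (a : Q) (m : L) i, B.repr (a ⊗ₜ m) i = a * algebraMap K Q (b.repr m i) := by
    intro a m i
    simp [B]
  have hl : ∀ (q : Q) (x : Q ⊗[K] L) i, B.repr ((q ⊗ₜ 1) * x) i = q * B.repr x i := by
    intro q x i
    induction x using TensorProduct.induction_on with
    | zero => simp
    | tmul a m => rw [Algebra.TensorProduct.tmul_mul_tmul, hB, hB, one_mul, mul_assoc]
    | add x y hx hy => rw [mul_add, map_add, map_add, Finsupp.add_apply, Finsupp.add_apply, hx, hy, mul_add]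
  have hr : ∀ (q : Q) (x : Q ⊗[K] L) i, B.repr (x * (q ⊗ₜ 1)) i = B.repr x i * q := by
    intro q x i
    induction x using TensorProduct.induction_on with
    | zero => simp
    | tmul a m => rw [Algebra.TensorProduct.tmul_mul_tmul, hB, hB, mul_one, mul_assoc, mul_assoc, Algebra.commutes]
    | add x y hx hy => rw [add_mul, map_add, map_add, Finsupp.add_apply, Finsupp.add_apply, hx, hy, add_mul]
  have hnt : Nontrivial (Q ⊗[K] L) := by
    infer_instance
  refine ⟨⟨fun I => ?_⟩⟩
  by_cases hI : I = ⊥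
  · exact Or.inl hI
  right
  have hex : ∃ x, x ∈ I ∧ x ≠ 0 := by
    by_contra! h
    apply hI
    rw [eq_bot_iff]
    intro x hx
    rw [h x hx]
    exact TwoSidedIdeal.zero_mem _
  have hex2 : ∃ N, ∃ x, x ∈ I ∧ x ≠ 0 ∧ (B.repr x).support.card = N := by
    obtain ⟨x, h1, h2⟩ := hex
    exact ⟨_, x, h1, h2, rfl⟩
  obtain ⟨x, hxI, hx0, hxN⟩ := Nat.find_spec hex2
  have hmin : ∀ y ∈ I, (B.repr y).support.card < (B.repr x).support.card → y = 0 := by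
    intro y hy h
    by_contra hne
    rw [hxN] at h
    exact Nat.find_min hex2 h ⟨y, hy, hne, rfl⟩
  obtain ⟨i0, hi0⟩ : (B.repr x).support.Nonempty := by
    rw [Finsupp.support_nonempty_iff]
    simpa using hx0
  let S : TwoSidedIdeal Q := TwoSidedIdeal.mk'
    {q | ∃ y ∈ I, (∀ i, B.repr x i = 0 → B.repr y i = 0) ∧ B.repr y i0 = q}
    ⟨0, I.zero_mem, by simp, by simp⟩
    (by
      rintro _ _ ⟨y, hy, h1, rfl⟩ ⟨z, hz, h2, rfl⟩
      exact ⟨y + z, I.add_mem hy hz, fun i hi => by simp [h1 i hi, h2 i hi], by simp⟩)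
    (by
      rintro _ ⟨y, hy, h1, rfl⟩
      exact ⟨-y, I.neg_mem hy, fun i hi => by simp [h1 i hi], by simp⟩)
    (by
      rintro q _ ⟨y, hy, h1, rfl⟩
      exact ⟨(q ⊗ₜ 1) * y, I.mul_mem_left _ _ hy, fun i hi => by rw [hl, h1 i hi, mul_zero], hl _ _ _⟩)
    (by
      rintro _ q ⟨y, hy, h1, rfl⟩
      exact ⟨y * (q ⊗ₜ 1), I.mul_mem_right _ _ hy, fun i hi => by rw [hr, h1 i hi, zero_mul], hr _ _ _⟩)
  have hS : ∀ q, q ∈ S ↔ ∃ y ∈ I, (∀ i, B.repr x i = 0 → B.repr y i = 0) ∧ B.repr y i0 = q := by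
    intro q
    exact TwoSidedIdeal.mem_mk' _ _ _ _ _ _ _
  have hStop : S = ⊤ := by
    rcases eq_bot_or_eq_top S with h | h
    · exfalso
      have h1 : B.repr x i0 ∈ S := (hS _).2 ⟨x, hxI, fun _ h => h, rfl⟩
      rw [h, TwoSidedIdeal.mem_bot] at h1
      simp at hi0
      exact hi0 h1
    · exact h
  obtain ⟨y, hyI, hys, hy1⟩ := (hS 1).1 (by rw [hStop]; trivial)
  have hcent : ∀ q : Q, (q ⊗ₜ 1) * y - y * (q ⊗ₜ 1) = 0 := by
    intro q
    apply hmin _ (I.sub_mem (I.mul_mem_left _ _ hyI) (I.mul_mem_right _ _ hyI))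
    apply Finset.card_lt_card
    rw [Finset.ssubset_iff_of_subset]
    · refine ⟨i0, hi0, ?_⟩
      simp [hl, hr, hy1]
    · intro i hi
      simp only [Finsupp.mem_support_iff, map_sub, Finsupp.sub_apply, hl, hr] at hi ⊢
      intro h
      apply hi
      simp [hys i h]
  have hci : ∀ i, ∃ c : K, algebraMap K Q c = B.repr y i := by
    intro i
    apply hc
    intro r
    have := congrArg (fun z => B.repr z i) (hcent r)
    simpa [hl, hr, sub_eq_zero] using this
  choose c hcc using hci
  have hy : ∃ l : L, y = 1 ⊗ₜ l := by
    refine ⟨∑ i ∈ (B.repr y).support, c i • b i, ?_⟩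
    conv_lhs => rw [← B.linearCombination_repr y]
    rw [Finsupp.linearCombination_apply, Finsupp.sum, TensorProduct.tmul_sum]
    refine Finset.sum_congr rfl fun i _ => ?_
    rw [← hcc, TensorProduct.tmul_smul, TensorProduct.smul_tmul', Algebra.TensorProduct.basis_apply,
      TensorProduct.smul_tmul', smul_eq_mul, mul_one, Algebra.algebraMap_eq_smul_one]
  obtain ⟨l, rfl⟩ := hy
  have hl0 : l ≠ 0 := by
    rintro rfl
    simp at hy1
  rw [eq_top_iff]
  intro z _
  have : z * (1 ⊗ₜ l⁻¹) * (1 ⊗ₜ l) = z := by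
    rw [mul_assoc, Algebra.TensorProduct.tmul_mul_tmul, inv_mul_cancel₀ hl0, one_mul,
      ← Algebra.TensorProduct.one_def, mul_one]
  rw [← this]
  exact I.mul_mem_left _ _ hyI
def capF {S : Type*} [Ring S] {N : ℕ} (z x y : Fin N → S) : S :=
  ∑ σ : Perm (Fin N), Perm.sign σ • (List.ofFn fun i => z i * x (σ i) * y i).prod

theorem map_capF {S S' : Type*} [Ring S] [Ring S'] (f : S →+* S') {N : ℕ} (z x y : Fin N → S) :
    f (capF z x y) = capF (f ∘ z) (f ∘ x) (f ∘ y) := by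
  simp only [capF, map_sum, Units.smul_def, map_zsmul, map_list_prod, List.map_ofFn]
  refine Finset.sum_congr rfl fun σ _ => ?_
  congr 3
  funext i
  simp

/-- the Capelli polynomial as an alternating map -/
def capAlt {R S : Type*} [CommRing R] [Ring S] [Algebra R S] {N : ℕ} (z y : Fin N → S) :
    S [⋀^Fin N]→ₗ[R] S :=
  MultilinearMap.alternatization ((MultilinearMap.mkPiAlgebraFin R N S).compLinearMap
    (fun i => (LinearMap.mulRight R (y i)).comp (LinearMap.mulLeft R (z i))))

theorem capAlt_apply {R S : Type*} [CommRing R] [Ring S] [Algebra R S] {N : ℕ} (z x y : Fin N → S) :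
    capAlt (R := R) z y x = capF z x y := by
  simp [capAlt, capF, MultilinearMap.alternatization_apply]

def eBasis (R : Type*) [CommRing R] (n : ℕ) :
    Module.Basis (Fin (n * n)) R (Matrix (Fin n) (Fin n) R) :=
  (Matrix.stdBasis R (Fin n) (Fin n)).reindex finProdFinEquiv

theorem trace_mulLeft (R : Type*) [CommRing R] (n : ℕ) (p : Matrix (Fin n) (Fin n) R) :
    (LinearMap.toMatrix (eBasis R n) (eBasis R n) (LinearMap.mulLeft R p)).trace = n * p.trace := by
  rw [Matrix.trace, ← finProdFinEquiv.sum_comp]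
  rw [Fintype.sum_prod_type]
  have : ∀ (i j : Fin n), (LinearMap.toMatrix (eBasis R n) (eBasis R n) (LinearMap.mulLeft R p)).diag
      (finProdFinEquiv (i, j)) = p i i := by
    intro i j
    simp only [Matrix.diag_apply, LinearMap.toMatrix_apply, eBasis, Module.Basis.repr_reindex_apply,
      Module.Basis.reindex_apply, Equiv.symm_apply_apply, Matrix.stdBasis_eq_single,
      LinearMap.mulLeft_apply]
    simp [Matrix.stdBasis]
  simp only [this]
  simp [Matrix.trace, Finset.mul_sum]

theorem det_deriv {R M : Type*} [CommRing R] [AddCommGroup M] [Module R M] {ι : Type*} [Fintype ι]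
    [DecidableEq ι] (e : Module.Basis ι R M) (f : M →ₗ[R] M) (x : ι → M) :
    ∑ i, e.det (Function.update x i (f (x i))) = (LinearMap.toMatrix e e f).trace * e.det x := by
  have h : ∀ i, e.det (Function.update x i (f (x i))) =
      ((e.toMatrix x).adjugate * (LinearMap.toMatrix e e f * e.toMatrix x)).diag i := by
    intro i
    rw [Module.Basis.det_apply, Module.Basis.toMatrix_update, ← Matrix.cramer_apply,
      Matrix.cramer_eq_adjugate_mulVec]
    have : ⇑(e.repr (f (x i))) = (LinearMap.toMatrix e e f * e.toMatrix x).col i := by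
      rw [← LinearMap.toMatrix_mulVec_repr e e f (x i)]
      rfl
    rw [this]
    rfl
  simp only [h]
  change Matrix.trace _ = _
  rw [Matrix.trace_mul_comm, mul_assoc, Matrix.mul_adjugate, Module.Basis.det_apply]
  simp [mul_comm]

theorem cap_trace {R : Type*} [CommRing R] {n : ℕ} (p : Matrix (Fin n) (Fin n) R)
    (z x y : Fin (n * n) → Matrix (Fin n) (Fin n) R) :
    ∑ i, capF z (Function.update x i (p * x i)) y = ((n : R) * p.trace) • capF z x y := by
  ext u v
  let F := (Matrix.entryLinearMap R R u v).compAlternatingMap (capAlt (R := R) z y)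
  have hF : ∀ x, capF z x y u v = F (eBasis R n) * (eBasis R n).det x := by
    intro x
    have := congrArg (fun G => G x) (AlternatingMap.eq_smul_basis_det (eBasis R n) F)
    simp only [AlternatingMap.smul_apply, smul_eq_mul] at this
    rw [← this]
    simp [F, capAlt_apply]
  rw [Matrix.sum_apply, Matrix.smul_apply, hF x]
  simp only [hF, smul_eq_mul]
  rw [← Finset.mul_sum]
  have := det_deriv (eBasis R n) (LinearMap.mulLeft R p) x
  simp only [LinearMap.mulLeft_apply, trace_mulLeft] at this
  rw [this]
  ring

theorem cap_ne_zero {R : Type*} [CommRing R] [Nontrivial R] {n : ℕ} (hn : 1 ≤ n) :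
    ∃ z x y : Fin (n * n) → Matrix (Fin n) (Fin n) R, capF z x y ≠ 0 := by
  let o : Fin n := ⟨0, hn⟩
  let e := (finProdFinEquiv (m := n) (n := n)).symm
  refine ⟨fun i => Matrix.single o (e i).1 1, fun i => Matrix.single (e i).1 (e i).2 1,
    fun i => Matrix.single (e i).2 o 1, ?_⟩
  have h : ∀ (i j : Fin (n * n)), Matrix.single o (e i).1 (1 : R) * Matrix.single (e j).1 (e j).2 1 *
      Matrix.single (e i).2 o 1 = if j = i then Matrix.single o o 1 else 0 := by
    intro i j
    split_ifs with hij
    · subst hij; simp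
    · by_cases h1 : (e i).1 = (e j).1
      · by_cases h2 : (e j).2 = (e i).2
        · exact absurd (e.injective (Prod.ext h1.symm h2)) hij
        · rw [mul_assoc, Matrix.single_mul_single_of_ne _ _ _ _ h2, mul_zero]
      · rw [Matrix.single_mul_single_of_ne _ _ _ _ h1, zero_mul]
  have : capF (fun i => Matrix.single o (e i).1 (1 : R)) (fun i => Matrix.single (e i).1 (e i).2 1)
      (fun i => Matrix.single (e i).2 o 1) = Matrix.single o o 1 := by
    rw [capF, Finset.sum_eq_single 1]
    · simp only [h, Perm.coe_one, id, if_true, Perm.sign_one, one_smul]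
      rw [List.ofFn_const, List.prod_replicate]
      obtain ⟨N, hN⟩ : ∃ N, n * n = N + 1 := ⟨n * n - 1, by have := Nat.mul_pos hn hn; omega⟩
      rw [hN]
      exact IsIdempotentElem.pow_succ_eq N (by simp [IsIdempotentElem])
    · intro σ _ hσ
      simp only [h]
      obtain ⟨i, hi⟩ : ∃ i, σ i ≠ i := by
        by_contra! hh
        exact hσ (Equiv.ext hh)
      rw [List.prod_eq_zero, smul_zero]
      rw [List.mem_ofFn]
      exact ⟨i, if_neg hi⟩
    · simp
  rw [this]
  intro h0
  have := congrFun (congrFun h0 o) o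
  simp at this

theorem multi_ne {L M M' : Type*} [Field L] [AddCommGroup M] [Module L M] [AddCommGroup M'] [Module L M']
    {N : ℕ} (f : MultilinearMap L (fun _ : Fin N => M) M') (S : Set M) (hS : Submodule.span L S = ⊤)
    (h : ∃ x, f x ≠ 0) : ∃ x, (∀ i, x i ∈ S) ∧ f x ≠ 0 := by
  by_contra! hh
  obtain ⟨x, hx⟩ := h
  apply hx
  have : f = 0 := by
    refine Module.Basis.ext_multilinear (fun _ => Module.Basis.ofSpan hS.ge) fun v => ?_
    rw [zero_apply]
    exact hh _ fun i => Module.Basis.ofSpan_subset hS.ge ⟨_, rfl⟩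
  rw [this]; rfl

theorem cap_ne_zero' {L : Type*} [Field L] {n : ℕ} (hn : 1 ≤ n)
    (S : Set (Matrix (Fin n) (Fin n) L)) (hS : Submodule.span L S = ⊤) :
    ∃ z x y : Fin (n * n) → Matrix (Fin n) (Fin n) L, (∀ i, z i ∈ S) ∧ (∀ i, x i ∈ S) ∧
      (∀ i, y i ∈ S) ∧ capF z x y ≠ 0 := by
  obtain ⟨z, x, y, h⟩ := cap_ne_zero (R := L) hn
  obtain ⟨x, hx, h⟩ := multi_ne (capAlt (R := L) z y).toMultilinearMap S hS ⟨x, by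
    simpa [capAlt_apply] using h⟩
  replace h : capF z x y ≠ 0 := by simpa [capAlt_apply] using h
  let fy : MultilinearMap L (fun _ : Fin (n * n) => Matrix (Fin n) (Fin n) L) (Matrix (Fin n) (Fin n) L) :=
    ∑ σ : Perm (Fin (n * n)), Perm.sign σ • (MultilinearMap.mkPiAlgebraFin L (n * n) _).compLinearMap
      (fun i => LinearMap.mulLeft L (z i * x (σ i)))
  have hfy : ∀ y, fy y = capF z x y := by
    intro y
    simp [fy, capF, mul_assoc]
  obtain ⟨y, hy, h⟩ := multi_ne fy S hS ⟨y, by rwa [hfy]⟩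
  rw [hfy] at h
  let fz : MultilinearMap L (fun _ : Fin (n * n) => Matrix (Fin n) (Fin n) L) (Matrix (Fin n) (Fin n) L) :=
    ∑ σ : Perm (Fin (n * n)), Perm.sign σ • (MultilinearMap.mkPiAlgebraFin L (n * n) _).compLinearMap
      (fun i => LinearMap.mulRight L (x (σ i) * y i))
  have hfz : ∀ z, fz z = capF z x y := by
    intro z
    simp [fz, capF, mul_assoc]
  obtain ⟨z, hz, h⟩ := multi_ne fz S hS ⟨z, by rwa [hfz]⟩
  rw [hfz] at h
  exact ⟨z, x, y, hz, hx, hy, h⟩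

theorem split_lemma (n : ℕ) (hn : 1 ≤ n) (R : Type) [Ring R] (h : HasPIDegree n R) :
    ∃ (L : Type) (_ : Field L) (φ : R →+* Matrix (Fin n) (Fin n) L), Function.Injective φ ∧
      Submodule.span L (Set.range φ) = ⊤ := by
  obtain ⟨Q, _, f, hf, hu, hfrac, hs, K, _, _, hcen, hdim⟩ := h
  have hcK : ∀ q : Q, (∀ r, r * q = q * r) → ∃ c : K, algebraMap K Q c = q := by
    intro q hq
    have : q ∈ (algebraMap K Q).range := by
      rw [hcen, Subring.mem_center_iff]
      exact hq
    exact this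
  have hfc : ∀ c ∈ Subring.center R, ∃ l : K, algebraMap K Q l = f c := by
    intro c hc
    apply hcK
    intro q
    obtain ⟨r, d, hd, hd0, hq⟩ := hfrac q
    rw [Subring.mem_center_iff] at hc hd
    apply (hu d (Subring.mem_center_iff.2 hd) hd0).mul_right_cancel
    rw [mul_assoc, ← map_mul, hc d |>.symm, mul_assoc, hq, map_mul, ← mul_assoc, hq,
      ← map_mul, ← map_mul, hc]
  have hfin : FiniteDimensional K Q := by
    apply Module.finite_of_finrank_pos
    rw [hdim]
    positivity
  let L := AlgebraicClosure K
  have hsimp : IsSimpleRing (L ⊗[K] Q) :=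
    (tensor_simple K Q L hcK).of_ringEquiv (Algebra.TensorProduct.comm K Q L).toRingEquiv
  obtain ⟨N, _, ⟨e⟩⟩ := IsSimpleRing.exists_algEquiv_matrix_of_isAlgClosed L (L ⊗[K] Q)
  have hN : N = n := by
    have h1 := e.toLinearEquiv.finrank_eq
    rw [Module.finrank_baseChange, hdim, Module.finrank_matrix] at h1
    simp at h1
    have : n ^ 2 = N ^ 2 := by rw [h1]; ring
    exact (Nat.pow_left_injective two_ne_zero this).symm
  subst hN
  let g : Q →+* Matrix (Fin N) (Fin N) L :=
    e.toRingEquiv.toRingHom.comp (Algebra.TensorProduct.includeRight : Q →ₐ[K] L ⊗[K] Q).toRingHom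
  have hg : ∀ q, g q = e (1 ⊗ₜ q) := fun q => rfl
  refine ⟨L, inferInstance, g.comp f, ?_, ?_⟩
  · exact (RingHom.injective g).comp hf
  · have h1 : ∀ q, g q ∈ Submodule.span L (Set.range (g.comp f)) := by
      intro q
      obtain ⟨r, c, hc, hc0, hq⟩ := hfrac q
      obtain ⟨l, hl⟩ := hfc c hc
      have hl0 : l ≠ 0 := by
        rintro rfl
        rw [map_zero] at hl
        exact hc0 (hf (by rw [← hl, map_zero]))
      have : g q = algebraMap K L l⁻¹ • (g.comp f) r := by
        rw [show (g.comp f) r = g (f r) from rfl, ← hq, ← hl, hg, hg, ← map_smul]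
        rw [TensorProduct.smul_tmul', ← Algebra.commutes, ← Algebra.smul_def, TensorProduct.tmul_smul,
          TensorProduct.smul_tmul', smul_eq_mul, mul_one, Algebra.smul_def, ← map_mul,
          mul_inv_cancel₀ hl0, map_one]
      rw [this]
      exact Submodule.smul_mem _ _ (Submodule.subset_span ⟨r, rfl⟩)
    rw [eq_top_iff]
    intro M _
    obtain ⟨t, rfl⟩ := e.surjective M
    induction t using TensorProduct.induction_on with
    | zero => simp
    | tmul l q =>
      have : e (l ⊗ₜ q) = l • g q := by
        rw [hg, ← map_smul, TensorProduct.smul_tmul', smul_eq_mul, mul_one]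
      rw [this]
      exact Submodule.smul_mem _ _ (h1 q)
    | add x y hx hy =>
      rw [map_add]
      exact Submodule.add_mem _ (hx trivial) (hy trivial)

theorem scalar_of_commute {n : ℕ} {L : Type*} [Field L] (S : Set (Matrix (Fin n) (Fin n) L))
    (hS : Submodule.span L S = ⊤) (M : Matrix (Fin n) (Fin n) L) (hM : ∀ s ∈ S, s * M = M * s) :
    ∃ l : L, algebraMap L (Matrix (Fin n) (Fin n) L) l = M := by
  have h : ∀ X, X * M = M * X := by
    intro X
    have hX : X ∈ Submodule.span L S := by rw [hS]; trivial
    induction hX using Submodule.span_induction with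
    | mem x h => exact hM x h
    | zero => simp
    | add x y _ _ hx hy => rw [add_mul, mul_add, hx, hy]
    | smul a x _ hx => rw [smul_mul_assoc, mul_smul_comm, hx]
  have : M ∈ Subalgebra.center L (Matrix (Fin n) (Fin n) L) := by
    rw [Subalgebra.mem_center_iff]; exact h
  rw [Algebra.IsCentral.center_eq_bot, Algebra.mem_bot] at this
  exact this

theorem spec_lemma {n m : ℕ} (hn : 1 ≤ n) (A : Subalgebra k (MatPoly k n m))
    (J : TwoSidedIdeal ↥A) (hJ : J ∈ SpecN n ↥A) :
    ∃ (L : Type) (_ : Field L) (_ : Algebra k L) (φ : ↥A →ₐ[k] Matrix (Fin n) (Fin n) L),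
      (∀ p, p ∈ J ↔ φ p = 0) ∧ Submodule.span L (Set.range φ) = ⊤ := by
  obtain ⟨_, hd⟩ := hJ
  obtain ⟨L, _, φ, hφ, hsp⟩ := split_lemma n hn _ hd
  let ψ : ↥A →+* Matrix (Fin n) (Fin n) L := φ.comp J.ringCon.mk'
  have hr : Set.range ψ = Set.range φ := by
    change Set.range (φ ∘ J.ringCon.mk') = _
    exact (RingCon.mk'_surjective J.ringCon).range_comp φ
  have hsc : ∀ c : k, ∃ l : L, algebraMap L (Matrix (Fin n) (Fin n) L) l = ψ (algebraMap k ↥A c) := by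
    intro c
    apply scalar_of_commute _ (by rw [hr]; exact hsp : Submodule.span L (Set.range ψ) = ⊤)
    rintro _ ⟨a, rfl⟩
    rw [← map_mul, ← map_mul, Algebra.commutes]
  choose g hg using hsc
  have : Nonempty (Fin n) := ⟨⟨0, hn⟩⟩
  have hinj : Function.Injective (algebraMap L (Matrix (Fin n) (Fin n) L)) :=
    FaithfulSMul.algebraMap_injective _ _
  let ι : k →+* L :=
    { toFun := g
      map_one' := hinj (by rw [hg]; simp)
      map_zero' := hinj (by rw [hg]; simp)
      map_mul' := fun a b => hinj (by rw [map_mul]; simp only [hg]; rw [map_mul, map_mul])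
      map_add' := fun a b => hinj (by rw [map_add]; simp only [hg]; rw [map_add, map_add]) }
  letI : Algebra k L := ι.toAlgebra
  refine ⟨L, inferInstance, inferInstance, { ψ with commutes' := fun c => ?_ }, ?_, ?_⟩
  · change ψ (algebraMap k ↥A c) = _
    rw [← hg, IsScalarTower.algebraMap_apply k L (Matrix (Fin n) (Fin n) L)]
    rfl
  · intro p
    change _ ↔ φ (J.ringCon.mk' p) = 0
    rw [map_eq_zero_iff φ hφ, TwoSidedIdeal.mem_iff, ← map_zero J.ringCon.mk']
    exact (RingCon.eq _).symm
  · change Submodule.span L (Set.range ψ) = ⊤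
    rw [hr]; exact hsp

theorem evalMat_generic {n m : ℕ} (a : MTuple k n m) (h : Fin m) :
    evalMat k a (genericMatrix k n m h) = a h := by
  ext i j
  simp [evalMat, genericMatrix, polyEval]

theorem evalMat_GMN {n m : ℕ} (a : MTuple k n m) (p : MatPoly k n m) (hp : p ∈ GMN k n m) :
    evalMat k a p ∈ Algebra.adjoin k (Set.range a) := by
  have : evalMat k a p ∈ (GMN k n m).map (evalMat k a) := ⟨p, hp, rfl⟩
  rw [GMN, AlgHom.map_adjoin, ← Set.range_comp] at this
  have h2 : (evalMat k a) ∘ genericMatrix k n m = a := by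
    funext h
    exact evalMat_generic k a h
  rwa [h2] at this

/-- matrix of coordinates -/
def coordMat {R : Type*} [CommRing R] {n : ℕ} (w : Fin n × Fin n → Matrix (Fin n) (Fin n) R) :
    Matrix (Fin n × Fin n) (Fin n × Fin n) R := Matrix.of fun i a => w a i.1 i.2

theorem coordMat_det {R : Type*} [CommRing R] {n : ℕ} (w : Fin n × Fin n → Matrix (Fin n) (Fin n) R) :
    (coordMat w).det = (Matrix.stdBasis R (Fin n) (Fin n)).det w := by
  rw [Module.Basis.det_apply]
  congr 1

theorem coordMat_det_map {R S : Type*} [CommRing R] [CommRing S] [Algebra k R] [Algebra k S] {n : ℕ}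
    (θ : R →ₐ[k] S)
    (w : Fin n × Fin n → Matrix (Fin n) (Fin n) R) :
    θ (coordMat w).det = (Matrix.stdBasis S (Fin n) (Fin n)).det (fun a => θ.mapMatrix (w a)) := by
  rw [← coordMat_det, AlgHom.map_det]
  rfl

theorem nullst {n m : ℕ} (A : Subalgebra k (MatPoly k n m)) (L : Type) [Field L] [Algebra k L]
    (θ : PolyRing k n m →ₐ[k] L) (J : TwoSidedIdeal ↥A)
    (hJ : ∀ p : ↥A, p ∈ J ↔ θ.mapMatrix (p : MatPoly k n m) = 0)
    (hspan : Submodule.span L (θ.mapMatrix '' (GMN k n m : Set (MatPoly k n m))) = ⊤) :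
    vanishIdeal k A (zeroLocusI k J) = J := by
  have hmem : ∀ p : ↥A, p ∈ vanishIdeal k A (zeroLocusI k J) ↔
      ∀ a ∈ zeroLocusI k J, evalMat k a (p : MatPoly k n m) = 0 := by
    intro p
    exact TwoSidedIdeal.mem_mk' _ _ _ _ _ _ _
  ext p
  rw [hmem]
  constructor
  swap
  · intro hp a ha
    exact ha.2 p hp
  intro hp
  obtain ⟨w, hwG, hw⟩ : ∃ w : Fin n × Fin n → MatPoly k n m, (∀ a, w a ∈ GMN k n m) ∧
      IsUnit ((Matrix.stdBasis L (Fin n) (Fin n)).det (fun a => θ.mapMatrix (w a))) := by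
    let b := Module.Basis.ofSpan hspan.ge
    let e := (Matrix.stdBasis L (Fin n) (Fin n)).indexEquiv b
    let b' := b.reindex e.symm
    have hb : ∀ a, ∃ w, w ∈ GMN k n m ∧ θ.mapMatrix w = b' a := by
      intro a
      have : b (e a) ∈ θ.mapMatrix '' (GMN k n m : Set (MatPoly k n m)) :=
        Module.Basis.ofSpan_subset hspan.ge ⟨_, rfl⟩
      simpa [b'] using this
    choose w hw1 hw2 using hb
    refine ⟨w, hw1, ?_⟩
    simp only [hw2]
    exact Module.Basis.isUnit_det _ b'
  have hδ : θ (coordMat w).det ≠ 0 := by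
    rw [coordMat_det_map]
    exact hw.ne_zero
  rw [hJ]
  ext i j
  change θ ((p : MatPoly k n m) i j) = 0
  have hprime : (RingHom.ker θ).IsPrime := RingHom.ker_isPrime _
  have hz : (coordMat w).det * (p : MatPoly k n m) i j ∈ RingHom.ker θ := by
    rw [← MvPolynomial.IsPrime.vanishingIdeal_zeroLocus (K := k) (RingHom.ker θ)]
    rw [MvPolynomial.mem_vanishingIdeal_iff]
    intro x hx
    rw [MvPolynomial.mem_zeroLocus_iff] at hx
    let a : MTuple k n m := fun h => Matrix.of fun i j => x (h, i, j)
    have hax : ∀ q, MvPolynomial.aeval x q = polyEval k a q := fun q => rfl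
    rw [hax, map_mul]
    by_cases hd : polyEval k a (coordMat w).det = 0
    · rw [hd, zero_mul]
    · have hgen : a ∈ genTuples k n m := by
        rw [coordMat_det_map] at hd
        have hd2 := ((Matrix.stdBasis k (Fin n) (Fin n)).is_basis_iff_det
          (v := fun a' => (polyEval k a).mapMatrix (w a'))).2 (isUnit_iff_ne_zero.2 hd)
        change Algebra.adjoin k (Set.range a) = ⊤
        rw [eq_top_iff]
        intro M _
        have hM : M ∈ Submodule.span k (Set.range fun a' => (polyEval k a).mapMatrix (w a')) := by
          rw [hd2.2]; trivial
        have hle : Submodule.span k (Set.range fun a' => (polyEval k a).mapMatrix (w a')) ≤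
            Subalgebra.toSubmodule (Algebra.adjoin k (Set.range a)) := by
          rw [Submodule.span_le]
          rintro _ ⟨a', rfl⟩
          exact evalMat_GMN k a _ (hwG a')
        exact hle hM
      have ha : a ∈ zeroLocusI k J := by
        refine ⟨hgen, fun q hq => ?_⟩
        rw [hJ] at hq
        ext i j
        exact hx _ (congrFun (congrFun hq i) j)
      have := congrFun (congrFun (hp a ha) i) j
      rw [show polyEval k a ((p : MatPoly k n m) i j) = 0 from this, mul_zero]
  rw [RingHom.mem_ker, map_mul] at hz
  exact (mul_eq_zero.1 hz).resolve_left hδ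

/-- the point over `L` defined by a representation -/
def ptHom {n m : ℕ} (L : Type) [Field L] [Algebra k L]
    (B : Fin m → Matrix (Fin n) (Fin n) L) : PolyRing k n m →ₐ[k] L :=
  MvPolynomial.aeval fun x : MIdx n m => B x.1 x.2.1 x.2.2

theorem gen_mem {n m : ℕ} (h : Fin m) : genericMatrix k n m h ∈ GMN k n m :=
  Algebra.subset_adjoin ⟨h, rfl⟩

theorem ptHom_agree {n m : ℕ} (L : Type) [Field L] [Algebra k L] (A : Subalgebra k (MatPoly k n m))
    (hA : GMN k n m ≤ A) (φ : ↥A →ₐ[k] Matrix (Fin n) (Fin n) L) (p : MatPoly k n m)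
    (hp : p ∈ GMN k n m) :
    φ ⟨p, hA hp⟩ = (ptHom k L (fun h => φ ⟨_, hA (gen_mem k h)⟩)).mapMatrix p := by
  induction hp using Algebra.adjoin_induction with
  | mem x hx =>
    obtain ⟨h, rfl⟩ := hx
    ext i j
    simp [ptHom, genericMatrix]
  | algebraMap r =>
    rw [AlgHom.commutes]
    exact φ.commutes r
  | add x y hx hy h1 h2 =>
    rw [map_add, ← h1, ← h2, ← map_add]
    rfl
  | mul x y hx hy h1 h2 =>
    rw [map_mul, ← h1, ← h2, ← map_mul]
    rfl

theorem traceScalar_mem {n m : ℕ} (p : MatPoly k n m) (hp : p ∈ GMN k n m) :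
    traceScalar k p ∈ TMN k n m :=
  Algebra.subset_adjoin (Or.inr ⟨p, hp, rfl⟩)

theorem span_G_of_T {n m : ℕ} (L : Type) [Field L] [Algebra k L]
    (φ : ↥(TMN k n m) →ₐ[k] Matrix (Fin n) (Fin n) L)
    (hsp : Submodule.span L (Set.range φ) = ⊤) :
    (∀ p (hp : p ∈ GMN k n m), ∃ l : L, algebraMap L (Matrix (Fin n) (Fin n) L) l =
      φ ⟨traceScalar k p, traceScalar_mem k p hp⟩) ∧
    Submodule.span L (φ '' {p | (p : MatPoly k n m) ∈ GMN k n m}) = ⊤ := by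
  have h1 : ∀ p (hp : p ∈ GMN k n m), ∃ l : L, algebraMap L (Matrix (Fin n) (Fin n) L) l =
      φ ⟨traceScalar k p, traceScalar_mem k p hp⟩ := by
    intro p hp
    apply scalar_of_commute _ hsp
    rintro _ ⟨a, rfl⟩
    rw [← map_mul, ← map_mul]
    congr 1
    apply Subtype.ext
    change (a : MatPoly k n m) * traceScalar k p = traceScalar k p * a
    exact (Algebra.commutes _ _).symm
  refine ⟨h1, ?_⟩
  let D : Subalgebra L (Matrix (Fin n) (Fin n) L) :=
    Algebra.adjoin L (φ '' {p | (p : MatPoly k n m) ∈ GMN k n m})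
  have hD : Subalgebra.toSubmodule D = Submodule.span L (φ '' {p | (p : MatPoly k n m) ∈ GMN k n m}) := by
    rw [Algebra.adjoin_eq_span]
    congr 1
    let G' : Submonoid (Matrix (Fin n) (Fin n) L) :=
      Submonoid.map φ ((GMN k n m).toSubsemiring.toSubmonoid.comap (TMN k n m).val)
    have : (G' : Set _) = φ '' {p | (p : MatPoly k n m) ∈ GMN k n m} := rfl
    rw [← this, Submonoid.closure_eq]
  rw [← hD, eq_top_iff, ← hsp, Submodule.span_le]
  rintro _ ⟨⟨p, hp⟩, rfl⟩
  change φ ⟨p, hp⟩ ∈ D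
  induction hp using Algebra.adjoin_induction with
  | mem x hx =>
    rcases hx with hx | ⟨y, hy, rfl⟩
    · exact Algebra.subset_adjoin ⟨⟨x, _⟩, hx, rfl⟩
    · obtain ⟨l, hl⟩ := h1 y hy
      rw [← hl]
      exact D.algebraMap_mem l
  | algebraMap r =>
    have : φ (algebraMap k _ r) ∈ D := by
      rw [φ.commutes, IsScalarTower.algebraMap_apply k L (Matrix (Fin n) (Fin n) L)]
      exact D.algebraMap_mem _
    exact this
  | add x y hx hy h1 h2 =>
    have := D.add_mem h1 h2
    rw [← map_add] at this
    exact this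
  | mul x y hx hy h1 h2 =>
    have := D.mul_mem h1 h2
    rw [← map_mul] at this
    exact this

theorem trace_compat {n m : ℕ} (hn : 1 ≤ n) (L : Type) [Field L] [Algebra k L]
    (φ : ↥(TMN k n m) →ₐ[k] Matrix (Fin n) (Fin n) L)
    (hsp : Submodule.span L (Set.range φ) = ⊤) (p : MatPoly k n m) (hp : p ∈ GMN k n m) :
    φ ⟨traceScalar k p, traceScalar_mem k p hp⟩ =
      algebraMap L (Matrix (Fin n) (Fin n) L) (φ ⟨p, GMN_le_TMN k n m hp⟩).trace := by
  obtain ⟨h1, h2⟩ := span_G_of_T k L φ hsp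
  obtain ⟨l, hl⟩ := h1 p hp
  rw [← hl]
  congr 1
  obtain ⟨z, x, y, hz, hx, hy, hne⟩ := cap_ne_zero' hn _ h2
  choose z' hz1 hz2 using hz
  choose x' hx1 hx2 using hx
  choose y' hy1 hy2 using hy
  obtain rfl : φ ∘ z' = z := funext hz2
  obtain rfl : φ ∘ x' = x := funext hx2
  obtain rfl : φ ∘ y' = y := funext hy2
  let P : ↥(TMN k n m) := ⟨p, GMN_le_TMN k n m hp⟩
  let τ : ↥(TMN k n m) := ⟨traceScalar k p, traceScalar_mem k p hp⟩
  have hT : ∑ i, capF z' (Function.update x' i (P * x' i)) y' = (n : ↥(TMN k n m)) * τ * capF z' x' y' := by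
    apply Subtype.val_injective
    have := cap_trace p ((TMN k n m).val ∘ z') ((TMN k n m).val ∘ x') ((TMN k n m).val ∘ y')
    have hc := fun z x y => map_capF ((TMN k n m).val : ↥(TMN k n m) →+* MatPoly k n m) (N := n * n) z x y
    change (TMN k n m).val (∑ i, capF z' (Function.update x' i (P * x' i)) y') =
      (TMN k n m).val ((n : ↥(TMN k n m)) * τ * capF z' x' y')
    rw [map_sum, map_mul, map_mul, map_natCast]
    have e1 : (TMN k n m).val (capF z' x' y') = capF ((TMN k n m).val ∘ z') ((TMN k n m).val ∘ x')
      ((TMN k n m).val ∘ y') := hc _ _ _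
    rw [e1]
    rw [Algebra.smul_def, map_mul, map_natCast] at this
    refine Eq.trans ?_ this
    refine Finset.sum_congr rfl fun i _ => ?_
    refine (hc _ _ _).trans ?_
    congr 1
    exact Function.comp_update _ _ _ _
  have hφ := congrArg φ hT
  have hc := fun z x y => map_capF (φ : ↥(TMN k n m) →+* Matrix (Fin n) (Fin n) L) (N := n * n) z x y
  have hc' : ∀ z x y, φ (capF (N := n * n) z x y) = capF (φ ∘ z) (φ ∘ x) (φ ∘ y) := hc
  rw [map_sum, map_mul, map_mul, map_natCast] at hφ
  simp only [hc', Function.comp_update, map_mul] at hφ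
  have hLtr := cap_trace (φ P) (φ ∘ z') (φ ∘ x') (φ ∘ y')
  have hφ2 := hLtr.symm.trans hφ
  have hτ : φ τ = algebraMap L _ l := hl.symm
  rw [hτ, ← map_natCast (algebraMap L (Matrix (Fin n) (Fin n) L)), ← map_mul, ← Algebra.smul_def,
    ] at hφ2
  have hch : CharZero L := charZero_of_injective_algebraMap (algebraMap k L).injective
  have hn0 : (n : L) ≠ 0 := by
    exact_mod_cast (by omega : n ≠ 0)
  have h3 := smul_left_injective L hne hφ2
  exact (mul_left_cancel₀ hn0 h3).symm

theorem ptHom_agree_T {n m : ℕ} (hn : 1 ≤ n) (L : Type) [Field L] [Algebra k L]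
    (φ : ↥(TMN k n m) →ₐ[k] Matrix (Fin n) (Fin n) L)
    (hsp : Submodule.span L (Set.range φ) = ⊤) (p : MatPoly k n m) (hp : p ∈ TMN k n m) :
    φ ⟨p, hp⟩ =
      (ptHom k L (fun h => φ ⟨_, GMN_le_TMN k n m (gen_mem k h)⟩)).mapMatrix p := by
  induction hp using Algebra.adjoin_induction with
  | mem x hx =>
    rcases hx with hx | ⟨y, hy, rfl⟩
    · exact ptHom_agree k L _ (GMN_le_TMN k n m) φ x hx
    · refine (trace_compat k hn L φ hsp y hy).trans ?_
      rw [ptHom_agree k L _ (GMN_le_TMN k n m) φ y hy, traceScalar]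
      ext i j
      simp only [AlgHom.mapMatrix_apply, Matrix.map_apply, Matrix.algebraMap_matrix_apply,
        Algebra.algebraMap_self, RingHom.id_apply]
      split_ifs
      · simp [Matrix.trace]
      · simp
  | algebraMap r =>
    rw [AlgHom.commutes]
    exact φ.commutes r
  | add x y hx hy h1 h2 =>
    rw [map_add, ← h1, ← h2, ← map_add]
    rfl
  | mul x y hx hy h1 h2 =>
    rw [map_mul, ← h1, ← h2, ← map_mul]
    rfl

end Helpers

/-- **Statement 12** (Strong form of the Nullstellensatz,
Proposition prop.strong-null).
(a) `I(Z(J₀)) = J₀` for every `J₀ ∈ Spec_n(G_{m,n})`.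
(b) `I_T(Z(J)) = J` for every `J ∈ Spec_n(T_{m,n})`. -/
theorem strong_nullstellensatz (n m : ℕ) (hn : 1 ≤ n) (hm : 2 ≤ m) :
    (∀ J₀ ∈ SpecN n ↥(GMN k n m),
      vanishIdeal k (GMN k n m) (zeroLocusI k J₀) = J₀) ∧
    (∀ J ∈ SpecN n ↥(TMN k n m),
      vanishIdeal k (TMN k n m) (zeroLocusI k J) = J) := by
  constructor
  · intro J hJ
    obtain ⟨L, _, _, φ, hker, hsp⟩ := spec_lemma k hn _ J hJ
    have key : ∀ p : ↥(GMN k n m), φ p = _ := fun p => ptHom_agree k L _ le_rfl φ p.1 p.2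
    refine nullst k _ L (ptHom k L (fun h => φ ⟨_, gen_mem k h⟩)) J ?_ ?_
    · intro p
      rw [hker, key]
    · rw [eq_top_iff, ← hsp]
      apply Submodule.span_mono
      rintro _ ⟨p, rfl⟩
      exact ⟨p, p.2, (key p).symm⟩
  · intro J hJ
    obtain ⟨L, _, _, φ, hker, hsp⟩ := spec_lemma k hn _ J hJ
    have key : ∀ p : ↥(TMN k n m), φ p = _ := fun p => ptHom_agree_T k hn L φ hsp p.1 p.2
    refine nullst k _ L
      (ptHom k L (fun h => φ ⟨_, GMN_le_TMN k n m (gen_mem k h)⟩)) J ?_ ?_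
    · intro p
      rw [hker, key]
    · rw [eq_top_iff, ← (span_G_of_T k L φ hsp).2]
      apply Submodule.span_mono
      rintro _ ⟨p, hp, rfl⟩
      exact ⟨p, hp, (key p).symm⟩

end
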